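/- Parallel timing anomaly for maximum composition: let Exp(θ) denote the exponential probability measure on [0,∞) with rate θ (CDF 1 − e^{−θt}), and let ∗ denote convolution of measures on [0,∞). Then (Exp(2) ∗ Exp(1))([0,2]) < (Exp(2) ∗ Exp(2))([0,2]), even though Exp(2)([0,t]) ≥ Exp(0.5)([0,t]) for all t ≥ 0. (Here Exp(2) = max-composition of Exp(2) and Exp(2), Exp(1) = max-composition of Exp(0.5) and Exp(1), and Exp(2) = max-composition of Exp(2) and Exp(1), where the maximum composition of two measures has CDF the pointwise maximum of their CDFs; the inequality witnesses that the composed faster process fails to dominate on the cylinder of two a-steps within time 2.) -/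

import Mathlib

open MeasureTheory Set
open scoped NNReal ENNReal

/-- Convolution of two measures on `ℝ≥0`: the pushforward of the product measure under
addition. -/
noncomputable def mconv (μ ν : Measure ℝ≥0) : Measure ℝ≥0 :=
  (μ.prod ν).map (fun p => p.1 + p.2)

lemma mconv_Iic (μ ν : Measure ℝ≥0) [SFinite ν] (t : ℝ≥0) :
    mconv μ ν (Iic t) = ∫⁻ x, ν {y | x + y ≤ t} ∂μ := by
  rw [mconv, Measure.map_apply (by fun_prop) measurableSet_Iic,
    Measure.prod_apply (measurableSet_Iic.preimage (by fun_prop))]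
  rfl

lemma setOf_add_le_eq_Iic_tsub {x t : ℝ≥0} (h : x ≤ t) : {y | x + y ≤ t} = Iic (t - x) := by
  ext y
  exact (le_tsub_iff_left h).symm

lemma setOf_add_le_eq_empty {x t : ℝ≥0} (h : t < x) : {y | x + y ≤ t} = ∅ :=
  eq_empty_of_forall_notMem fun _ hy => absurd (le_self_add.trans hy) (not_le.2 h)

/-- Convolution with a fixed measure is monotone for domination of CDFs, strictly so at `t` when
the fixed measure charges a set on which the shifted CDFs are strictly ordered. -/
lemma mconv_Iic_lt_mconv_Iic {μ ν ρ : Measure ℝ≥0} [IsProbabilityMeasure μ]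
    [IsProbabilityMeasure ν] [IsProbabilityMeasure ρ] {s t : ℝ≥0} (hst : s ≤ t)
    (hle : ∀ a, ν (Iic a) ≤ ρ (Iic a)) (hlt : ∀ a, t - s ≤ a → ν (Iic a) < ρ (Iic a))
    (hs : μ (Iic s) ≠ 0) : mconv μ ν (Iic t) < mconv μ ρ (Iic t) := by
  rw [mconv_Iic, mconv_Iic]
  have hmeas : Measurable fun x => ρ {y | x + y ≤ t} :=
    measurable_measure_prodMk_left (measurableSet_le (by fun_prop) measurable_const :
      MeasurableSet {p : ℝ≥0 × ℝ≥0 | p.1 + p.2 ≤ t})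
  refine lintegral_strict_mono_of_ae_le_of_ae_lt_on hmeas.aemeasurable ?_
    (.of_forall fun x => ?_) hs (.of_forall fun x hx => ?_)
  · refine ne_of_lt (lt_of_le_of_lt (lintegral_mono fun x => prob_le_one) ?_)
    simp
  · rcases le_or_gt x t with h | h
    · simpa only [setOf_add_le_eq_Iic_tsub h] using hle (t - x)
    · simp [setOf_add_le_eq_empty h]
  · rw [setOf_add_le_eq_Iic_tsub (hx.trans hst)]
    exact hlt _ (tsub_le_tsub_left hx t)

lemma ofReal_one_sub_exp_le {a b : ℝ} (hab : a ≤ b) (t : ℝ≥0) :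
    ENNReal.ofReal (1 - Real.exp (-(a * t))) ≤ ENNReal.ofReal (1 - Real.exp (-(b * t))) := by
  gcongr

lemma ofReal_one_sub_exp_lt {a b : ℝ} (hb : 0 < b) (hab : a < b) {t : ℝ≥0} (ht : 0 < t) :
    ENNReal.ofReal (1 - Real.exp (-(a * t))) < ENNReal.ofReal (1 - Real.exp (-(b * t))) := by
  have ht' : (0 : ℝ) < t := ht
  rw [ENNReal.ofReal_lt_ofReal_iff (by simpa using mul_pos hb ht')]
  gcongr

/-- Parallel timing anomaly for maximum composition: even though `Exp 2` dominates
`Exp 0.5` pointwise, the convolution `Exp 2 ∗ Exp 1` (the max-composed rates of the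
faster component with the context) assigns less probability to `[0,2]` than
`Exp 2 ∗ Exp 2` (the max-composed rates of the slower component) does. -/
theorem maximum_composition_timing_anomaly
    (e1 e05 e2 : Measure ℝ≥0)
    (h1p : IsProbabilityMeasure e1) (h05p : IsProbabilityMeasure e05)
    (h2p : IsProbabilityMeasure e2)
    (h1 : ∀ t : ℝ≥0, e1 (Set.Iic t) = ENNReal.ofReal (1 - Real.exp (-(1 * t))))
    (h05 : ∀ t : ℝ≥0, e05 (Set.Iic t) = ENNReal.ofReal (1 - Real.exp (-((1/2) * t))))
    (h2 : ∀ t : ℝ≥0, e2 (Set.Iic t) = ENNReal.ofReal (1 - Real.exp (-(2 * t)))) :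
    (∀ t : ℝ≥0, e05 (Set.Iic t) ≤ e2 (Set.Iic t)) ∧
    mconv e2 e1 (Set.Iic 2) < mconv e2 e2 (Set.Iic 2) := by
  refine ⟨fun t => ?_, mconv_Iic_lt_mconv_Iic (s := 1) one_le_two (fun a => ?_) (fun a ha => ?_) ?_⟩
  · rw [h05, h2]
    exact ofReal_one_sub_exp_le (by norm_num) t
  · rw [h1, h2]
    exact ofReal_one_sub_exp_le one_le_two a
  · rw [h1, h2]
    exact ofReal_one_sub_exp_lt two_pos one_lt_two
      ((tsub_pos_of_lt one_lt_two).trans_le ha)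
  · rw [h2]
    simp
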